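/- arXiv:2010.05008 — 3 statements merged into one kernel-verified Lean document; each statement's English description precedes it below -/
import Mathlib

section
/- If the parameter β > 0 satisfies β^α v ≤ (α−1)/2^α − α·log(ε^{−1})/(2^{α−1} n), then each of the equations B_+(θ) = 0 and B_−(θ) = 0 has at least one real solution. -/
open Real

/-- A function `t ↦ -t + c (v + |t|^α) + K` with nonnegative parameters that is
nonpositive at some `x ≥ 0` has a zero. -/
lemma exists_zero_neg_add_mul_abs_rpow {α c v K x : ℝ} (hα : 0 < α) (hc : 0 ≤ c) (hv : 0 ≤ v)
    (hK : 0 ≤ K) (hx : 0 ≤ x) (hneg : -x + c * (v + |x| ^ α) + K ≤ 0) :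
    ∃ t : ℝ, -t + c * (v + |t| ^ α) + K = 0 := by
  have hcont : Continuous fun t : ℝ => -t + c * (v + |t| ^ α) + K := by
    have : Continuous fun t : ℝ => |t| ^ α :=
      continuous_abs.rpow_const fun _ => Or.inr hα.le
    fun_prop
  have hzero : 0 ≤ -(0 : ℝ) + c * (v + |(0 : ℝ)| ^ α) + K := by
    rw [abs_zero, Real.zero_rpow hα.ne']
    have := mul_nonneg hc hv
    linarith
  obtain ⟨t, -, ht⟩ := intermediate_value_Icc' hx hcont.continuousOn ⟨hneg, hzero⟩
  exact ⟨t, ht⟩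

/-- The parameter condition makes the Catoni bound nonpositive at distance `1 / (2β)`. -/
lemma catoni_bound_nonpos {α v β L N : ℝ} (hα : 0 < α) (hβ : 0 < β) (hN : 0 < N)
    (hcond : β ^ α * v ≤ (α - 1) / 2 ^ α - α * L / (2 ^ (α - 1) * N)) :
    -(1 / (2 * β)) + (2 * β) ^ (α - 1) / α * (v + |1 / (2 * β)| ^ α) + L / (N * β) ≤ 0 := by
  have h2β : 0 < 2 * β := by positivity
  have hx : |1 / (2 * β)| ^ α = 1 / (2 * β) ^ α := by
    rw [abs_of_pos (by positivity), Real.div_rpow zero_le_one h2β.le, Real.one_rpow]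
  rw [Real.rpow_sub_one two_ne_zero] at hcond
  rw [hx, Real.rpow_sub_one h2β.ne', Real.mul_rpow zero_le_two hβ.le]
  have hA : 0 < (2 : ℝ) ^ α := by positivity
  have hB : 0 < β ^ α := by positivity
  generalize (2 : ℝ) ^ α = A at *
  generalize β ^ α = B at *
  have hscaled : A * (B * v) ≤ α - 1 - 2 * α * L / N := by
    calc A * (B * v) ≤ A * ((α - 1) / A - α * L / (A / 2 * N)) := by gcongr
      _ = α - 1 - 2 * α * L / N := by field_simp
  have hfactor : -(1 / (2 * β)) + A * B / (2 * β) / α * (v + 1 / (A * B)) + L / (N * β) =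
      (A * (B * v) - (α - 1 - 2 * α * L / N)) / (2 * β * α) := by
    field_simp
    ring
  rw [hfactor]
  exact div_nonpos_of_nonpos_of_nonneg (by linarith) (by positivity)

/-- if `β^α v ≤ (α-1)/2^α - α log(ε⁻¹)/(2^(α-1) n)`, then both
`B₊(θ) = 0` and `B₋(θ) = 0` have at least one real solution. -/
theorem catoni_equations_solvable
    (α m v : ℝ) (hα : α ∈ Set.Ioo (1 : ℝ) 2) (hv : 0 < v)
    (n : ℕ) (hn : 1 ≤ n)
    (β : ℝ) (hβ : 0 < β)
    (ε : ℝ) (hε : ε ∈ Set.Ioo (0 : ℝ) (1 / 2))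
    (Bp Bm : ℝ → ℝ)
    (hBp : ∀ θ, Bp θ = m - θ + (2 * β) ^ (α - 1) / α * (v + |m - θ| ^ α) +
      Real.log ε⁻¹ / (n * β))
    (hBm : ∀ θ, Bm θ = m - θ - (2 * β) ^ (α - 1) / α * (v + |m - θ| ^ α) -
      Real.log ε⁻¹ / (n * β))
    (hcond : β ^ α * v ≤ (α - 1) / 2 ^ α - α * Real.log ε⁻¹ / (2 ^ (α - 1) * n)) :
    (∃ θ : ℝ, Bp θ = 0) ∧ (∃ θ : ℝ, Bm θ = 0) := by
  obtain ⟨hα1, -⟩ := hα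
  obtain ⟨hε0, hε1⟩ := hε
  have hα0 : 0 < α := by linarith
  have hN : (0 : ℝ) < n := by exact_mod_cast hn
  have hL : 0 ≤ Real.log ε⁻¹ :=
    Real.log_nonneg ((one_le_inv₀ hε0).mpr (by linarith))
  obtain ⟨t, ht⟩ := exists_zero_neg_add_mul_abs_rpow hα0 (by positivity) hv.le
    (by positivity) (by positivity) (catoni_bound_nonpos hα0 hβ hN hcond)
  refine ⟨⟨m + t, ?_⟩, ⟨m - t, ?_⟩⟩
  · rw [hBp, sub_add_cancel_left, abs_neg]
    exact ht
  · rw [hBm, sub_sub_cancel]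
    linarith
end

section
/- If the parameter β > 0 satisfies ((2β)^{α−1}/α)(v + 1) + log(ε^{−1})/(nβ) ≤ 1, then the equation B_+(θ) = 0 has a smallest solution θ_+ and θ_+ ∈ (m, m+1], and the equation B_−(θ) = 0 has a largest solution θ_− and θ_− ∈ [m−1, m). -/
open Real

/-- A continuous function that is positive on `(-∞, a]` and nonpositive at some `b ≥ a` has a
smallest zero, and this zero lies in `(a, b]`. -/
theorem exists_isLeast_zero_of_pos_Iic {f : ℝ → ℝ} (hf : Continuous f) {a b : ℝ} (hab : a ≤ b)
    (hpos : ∀ x ≤ a, 0 < f x) (hb : f b ≤ 0) :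
    ∃ s, IsLeast {x | f x = 0} s ∧ s ∈ Set.Ioc a b := by
  obtain ⟨x, hx, hx0⟩ := intermediate_value_Icc' hab hf.continuousOn ⟨hb, (hpos a le_rfl).le⟩
  have hlt : ∀ y ∈ {y | f y = 0}, a < y := fun y hy =>
    lt_of_not_ge fun hya => (hpos y hya).ne' hy
  have hleast : IsLeast {y | f y = 0} (sInf {y | f y = 0}) :=
    (isClosed_eq hf continuous_const).isLeast_csInf ⟨x, hx0⟩ ⟨a, fun y hy => (hlt y hy).le⟩
  exact ⟨_, hleast, hlt _ hleast.1, (hleast.2 hx0).trans hx.2⟩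

/-- if `((2β)^(α-1)/α)(v+1) + log(ε⁻¹)/(nβ) ≤ 1`, then `B₊ = 0` has a
smallest solution `θ₊ ∈ (m, m+1]` and `B₋ = 0` has a largest solution `θ₋ ∈ [m-1, m)`. -/
theorem catoni_extreme_solutions
    (α m v : ℝ) (hα : α ∈ Set.Ioo (1 : ℝ) 2) (hv : 0 < v)
    (n : ℕ) (hn : 1 ≤ n)
    (β : ℝ) (hβ : 0 < β)
    (ε : ℝ) (hε : ε ∈ Set.Ioo (0 : ℝ) (1 / 2))
    (Bp Bm : ℝ → ℝ)
    (hBp : ∀ θ, Bp θ = m - θ + (2 * β) ^ (α - 1) / α * (v + |m - θ| ^ α) +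
      Real.log ε⁻¹ / (n * β))
    (hBm : ∀ θ, Bm θ = m - θ - (2 * β) ^ (α - 1) / α * (v + |m - θ| ^ α) -
      Real.log ε⁻¹ / (n * β))
    (hcond : (2 * β) ^ (α - 1) / α * (v + 1) + Real.log ε⁻¹ / (n * β) ≤ 1) :
    (∃ θp : ℝ, IsLeast {θ : ℝ | Bp θ = 0} θp ∧ θp ∈ Set.Ioc m (m + 1)) ∧
    (∃ θm : ℝ, IsGreatest {θ : ℝ | Bm θ = 0} θm ∧ θm ∈ Set.Ico (m - 1) m) := by
  obtain ⟨hα1, -⟩ := hα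
  obtain ⟨hε0, hε1⟩ := hε
  have hc : 0 < (2 * β) ^ (α - 1) / α := by positivity
  have hL : 0 ≤ Real.log ε⁻¹ / (n * β) :=
    div_nonneg (Real.log_nonneg ((one_le_inv₀ hε0).2 (by linarith))) (by positivity)
  generalize (2 * β) ^ (α - 1) / α = c at *
  generalize Real.log ε⁻¹ / (n * β) = L at *
  have hcont : Continuous fun t : ℝ => -t + c * (v + |t| ^ α) + L := by
    have : Continuous fun t : ℝ => |t| ^ α :=
      continuous_abs.rpow_const fun _ => Or.inr (by linarith)
    fun_prop
  obtain ⟨s, ⟨hs0, hsmin⟩, hs, hs1⟩ := exists_isLeast_zero_of_pos_Iic hcont zero_le_one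
    (fun t ht => by
      have : 0 < c * (v + |t| ^ α) := by positivity
      linarith)
    (by simp only [abs_one, Real.one_rpow]; linarith)
  simp only [Set.mem_ofPred_eq] at hs0
  refine ⟨⟨m + s, ⟨?_, fun θ hθ => ?_⟩, by linarith, by linarith⟩,
    ⟨m - s, ⟨?_, fun θ hθ => ?_⟩, by linarith, by linarith⟩⟩
  · rw [Set.mem_ofPred_eq, hBp, abs_sub_comm, add_sub_cancel_left]
    linarith
  · rw [Set.mem_ofPred_eq, hBp, abs_sub_comm] at hθ
    have : s ≤ θ - m := hsmin (by rw [Set.mem_ofPred_eq]; linarith)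
    linarith
  · rw [Set.mem_ofPred_eq, hBm, sub_sub_cancel]
    linarith
  · rw [Set.mem_ofPred_eq, hBm] at hθ
    have : s ≤ m - θ := hsmin (by rw [Set.mem_ofPred_eq]; linarith)
    linarith
end

section
/- The function B_+ is strictly decreasing on the interval (m, m + 1/(2β)), nondecreasing on [m + 1/(2β), ∞), is positive for θ ≤ m, and its value at the point m + 1/(2β) equals B_+(m + 1/(2β)) = (2^{α−1}/(αβ))·( β^{α} v − (α−1)/2^{α} + α·log(ε^{−1})/(2^{α−1} n) ). In particular, if β^{α} v ≤ (α−1)/2^{α} − α·log(ε^{−1})/(2^{α−1} n), then B_+(m + 1/(2β)) ≤ 0. -/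
open Real

lemma hasDerivAt_rpow_div_sub_id {p : ℝ} (hp : 1 < p) (s : ℝ) :
    HasDerivAt (fun s : ℝ => s ^ p / p - s) (s ^ (p - 1) - 1) s := by
  have h := ((Real.hasDerivAt_rpow_const (x := s) (Or.inr hp.le)).div_const p).sub (hasDerivAt_id s)
  rwa [mul_div_cancel_left₀ _ (by linarith)] at h

lemma strictAntiOn_rpow_div_sub_id {p : ℝ} (hp : 1 < p) :
    StrictAntiOn (fun s : ℝ => s ^ p / p - s) (Set.Icc 0 1) := by
  refine strictAntiOn_of_deriv_neg (convex_Icc 0 1)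
    (fun s _ => (hasDerivAt_rpow_div_sub_id hp s).continuousAt.continuousWithinAt) fun s hs => ?_
  rw [interior_Icc] at hs
  rw [(hasDerivAt_rpow_div_sub_id hp s).deriv, sub_neg]
  exact Real.rpow_lt_one hs.1.le hs.2 (sub_pos.2 hp)

lemma monotoneOn_rpow_div_sub_id {p : ℝ} (hp : 1 < p) :
    MonotoneOn (fun s : ℝ => s ^ p / p - s) (Set.Ici 1) := by
  refine monotoneOn_of_deriv_nonneg (convex_Ici 1)
    (fun s _ => (hasDerivAt_rpow_div_sub_id hp s).continuousAt.continuousWithinAt)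
    (fun s _ => (hasDerivAt_rpow_div_sub_id hp s).differentiableAt.differentiableWithinAt)
    fun s hs => ?_
  rw [interior_Ici] at hs
  rw [(hasDerivAt_rpow_div_sub_id hp s).deriv, sub_nonneg]
  exact Real.one_le_rpow (le_of_lt hs) (sub_pos.2 hp).le

/-- monotonicity properties of `B₊`: strictly decreasing on
`(m, m + 1/(2β))`, nondecreasing on `[m + 1/(2β), ∞)`, positive for `θ ≤ m`, and its
value at `m + 1/(2β)` is `(2^(α-1)/(αβ))(β^α v - (α-1)/2^α + α log(ε⁻¹)/(2^(α-1) n))`;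
in particular this value is `≤ 0` under the stated smallness condition on `β`. -/
theorem Bplus_shape
    (α m v : ℝ) (hα : α ∈ Set.Ioo (1 : ℝ) 2) (hv : 0 < v)
    (n : ℕ) (hn : 1 ≤ n)
    (β : ℝ) (hβ : 0 < β)
    (ε : ℝ) (hε : ε ∈ Set.Ioo (0 : ℝ) (1 / 2))
    (Bp : ℝ → ℝ)
    (hBp : ∀ θ, Bp θ = m - θ + (2 * β) ^ (α - 1) / α * (v + |m - θ| ^ α) +
      Real.log ε⁻¹ / (n * β)) :
    StrictAntiOn Bp (Set.Ioo m (m + 1 / (2 * β))) ∧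
    MonotoneOn Bp (Set.Ici (m + 1 / (2 * β))) ∧
    (∀ θ ≤ m, 0 < Bp θ) ∧
    Bp (m + 1 / (2 * β)) =
      2 ^ (α - 1) / (α * β) *
        (β ^ α * v - (α - 1) / 2 ^ α + α * Real.log ε⁻¹ / (2 ^ (α - 1) * n)) ∧
    (β ^ α * v ≤ (α - 1) / 2 ^ α - α * Real.log ε⁻¹ / (2 ^ (α - 1) * n) →
      Bp (m + 1 / (2 * β)) ≤ 0) := by
  obtain ⟨hα1, -⟩ := hα
  obtain ⟨hε0, hε1⟩ := hε
  have hα0 : 0 < α := by linarith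
  have hn0 : (0 : ℝ) < n := by exact_mod_cast hn
  have hc : 0 < 2 * β := by positivity
  have hL : 0 < Real.log ε⁻¹ := Real.log_pos ((one_lt_inv₀ hε0).2 (by linarith))
  -- On `[m, ∞)`, `Bp` is an affine image of `s ↦ s ^ α / α - s` at `s = 2 * β * (θ - m)`.
  have key : ∀ θ, m ≤ θ → Bp θ = 1 / (2 * β) *
      ((2 * β * (θ - m)) ^ α / α - 2 * β * (θ - m)) +
        ((2 * β) ^ (α - 1) / α * v + Real.log ε⁻¹ / (n * β)) := by
    intro θ hθ
    rw [hBp, abs_sub_comm, abs_of_nonneg (sub_nonneg.2 hθ),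
      Real.mul_rpow hc.le (sub_nonneg.2 hθ), Real.rpow_sub_one hc.ne']
    field_simp
    ring
  have hr : 2 * β * (m + 1 / (2 * β) - m) = 1 := by
    field_simp
    ring
  have hle : m ≤ m + 1 / (2 * β) := le_add_of_nonneg_right (by positivity)
  have hval : Bp (m + 1 / (2 * β)) = 2 ^ (α - 1) / (α * β) *
      (β ^ α * v - (α - 1) / 2 ^ α + α * Real.log ε⁻¹ / (2 ^ (α - 1) * n)) := by
    rw [key _ hle, hr, Real.one_rpow, Real.rpow_sub_one hc.ne', Real.rpow_sub_one two_ne_zero,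
      Real.mul_rpow zero_le_two hβ.le]
    have h2 : (0 : ℝ) < 2 ^ α := by positivity
    field_simp
    ring
  refine ⟨fun x hx y hy hxy => ?_, fun x hx y hy hxy => ?_, fun θ hθ => ?_, hval, fun h => ?_⟩
  · have hmem : ∀ z ∈ Set.Ioo m (m + 1 / (2 * β)), 2 * β * (z - m) ∈ Set.Icc (0 : ℝ) 1 :=
      fun z hz => ⟨mul_nonneg hc.le (sub_nonneg.2 hz.1.le), hr ▸ by gcongr; exact hz.2.le⟩
    rw [key x hx.1.le, key y hy.1.le]
    gcongr ?_ * ?_ + _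
    exact strictAntiOn_rpow_div_sub_id hα1 (hmem x hx) (hmem y hy) (by gcongr)
  · have hmem : ∀ z ∈ Set.Ici (m + 1 / (2 * β)), 2 * β * (z - m) ∈ Set.Ici (1 : ℝ) :=
      fun z hz => hr.symm.le.trans (by gcongr; exact hz)
    rw [key x (hle.trans hx), key y (hle.trans hy)]
    gcongr ?_ * ?_ + _
    exact monotoneOn_rpow_div_sub_id hα1 (hmem x hx) (hmem y hy) (by gcongr)
  · rw [hBp]
    have := sub_nonneg.2 hθ
    positivity
  · rw [hval]
    exact mul_nonpos_of_nonneg_of_nonpos (by positivity) (by linarith)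
end
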